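/- arXiv:2511.08662 — 2 statements merged into one kernel-verified Lean document; each statement's English description precedes it below -/
import Mathlib

section
/- Let γ_n be a step function on (0,1) with finitely many steps, let γ_{ξ,n}↑ be its L²(0,1)-projection onto F⁻¹_{U,ξ}, and set â_{ξ,n} = ∫₀¹ γ_{ξ,n}↑(u) du, b̂_{ξ,n} = (∫₀¹ (γ_{ξ,n}↑(u) − â_{ξ,n})² du)^{1/2}, h_{ξ,n}↑ = μ + σ (γ_{ξ,n}↑ − â_{ξ,n})/b̂_{ξ,n}, and h_ξ↑ = μ + σ (γ_ξ↑ − â_ξ)/b̂_ξ. If γ_ξ↑ and γ_{ξ,n}↑ are not constants, then: (1) ‖γ_{ξ,n}↑ − γ_ξ↑‖₂ ≤ ‖γ_n − γ‖₂; (2) ‖h_{ξ,n}↑ − h_ξ↑‖₂ ≤ (2 + (2‖γ‖₂ + ‖γ_n‖₂)/b̂_ξ) (σ/b̂_ξ) ‖γ_n − γ‖₂; (3) |ρ_g(h_ξ↑) − ρ_g(h_{ξ,n}↑)| ≤ σ (2‖γ‖₂ + ‖γ_n‖₂) ‖γ_n − γ‖₂ / b̂_ξ, where ‖·‖₂ denotes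 the L²(0,1) norm. -/
open MeasureTheory Set Filter

noncomputable section

/-- Left quantile function of a distribution function `G`. -/
def leftQ (G : ℝ → ℝ) (p : ℝ) : ℝ := sInf {x : ℝ | p ≤ G x}

/-- `G` is a cumulative distribution function. -/
def IsCDF (G : ℝ → ℝ) : Prop :=
  Monotone G ∧ (∀ x : ℝ, ContinuousWithinAt G (Ici x) x) ∧
    Tendsto G atBot (nhds 0) ∧ Tendsto G atTop (nhds 1)

/-- `G ∈ M²`: a cdf with finite second moment. -/
def MemM2 (G : ℝ → ℝ) : Prop :=
  IsCDF G ∧ IntegrableOn (fun t => (leftQ G t) ^ 2) (Ioo (0:ℝ) 1)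

/-- Mean of `f(V)` for `V` uniform on `(0,1)`. -/
def mean01 (f : ℝ → ℝ) : ℝ := ∫ t in Ioo (0:ℝ) 1, f t

/-- Variance of `f(V)` for `V` uniform on `(0,1)`. -/
def var01 (f : ℝ → ℝ) : ℝ := ∫ t in Ioo (0:ℝ) 1, (f t - mean01 f) ^ 2

/-- Covariance of `f(V)` and `h(V)` for `V` uniform on `(0,1)`. -/
def cov01 (f h : ℝ → ℝ) : ℝ := ∫ t in Ioo (0:ℝ) 1, (f t - mean01 f) * (h t - mean01 h)

/-- Pearson correlation of `f(V)` and `h(V)` for `V` uniform on `(0,1)`. -/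
def corr01 (f h : ℝ → ℝ) : ℝ := cov01 f h / (Real.sqrt (var01 f) * Real.sqrt (var01 h))

/-- Standard deviation of `f(V)` for `V` uniform on `(0,1)`. -/
def sd01 (f : ℝ → ℝ) : ℝ := Real.sqrt (var01 f)

/-- `L²(0,1)` norm. -/
def l2norm (f : ℝ → ℝ) : ℝ := Real.sqrt (∫ u in Ioo (0:ℝ) 1, (f u) ^ 2)

/-- Distortion risk metric expressed via the quantile function:
`ρ_g(h) = ∫₀¹ γ(u) h(u) du` where `γ` is the weight function of `g`. -/
def rhoQ (γ h : ℝ → ℝ) : ℝ := ∫ u in Ioo (0:ℝ) 1, γ u * h u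

/-- `h` belongs to `F⁻¹_{U,ξ}`: it is a quantile function of a unimodal distribution with
inflection point `ξ`, i.e. nondecreasing and continuous on `(0,1)`, concave on `(0,ξ)`,
convex on `(ξ,1)`, and square integrable on `(0,1)`. -/
def UQuant (ξ : ℝ) (h : ℝ → ℝ) : Prop :=
  MonotoneOn h (Ioo (0:ℝ) 1) ∧ ContinuousOn h (Ioo (0:ℝ) 1) ∧
    ConcaveOn ℝ (Ioo (0:ℝ) ξ) h ∧ ConvexOn ℝ (Ioo ξ 1) h ∧
    IntegrableOn (fun t => (h t) ^ 2) (Ioo (0:ℝ) 1)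

/-- `γp` is the `L²(0,1)`-projection of `γ` onto `F⁻¹_{U,ξ}`. -/
def IsProj (ξ : ℝ) (γ γp : ℝ → ℝ) : Prop :=
  UQuant ξ γp ∧ ∀ h : ℝ → ℝ, UQuant ξ h →
    (∫ u in Ioo (0:ℝ) 1, (γ u - γp u) ^ 2) ≤ ∫ u in Ioo (0:ℝ) 1, (γ u - h u) ^ 2

/-- `G ∈ F_{U,ξ}`: `G` is a unimodal cdf in `M²` with inflection point `ξ`. -/
def UnimodalCDF (ξ : ℝ) (G : ℝ → ℝ) : Prop :=
  MemM2 G ∧ ContinuousOn (leftQ G) (Ioo (0:ℝ) 1) ∧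
    ConcaveOn ℝ (Ioo (0:ℝ) ξ) (leftQ G) ∧ ConvexOn ℝ (Ioo ξ 1) (leftQ G)

/-- `F_{U,ξ}(μ,σ)`. -/
def FUset (ξ μ σ : ℝ) : Set (ℝ → ℝ) :=
  {G | UnimodalCDF ξ G ∧ mean01 (leftQ G) = μ ∧
    mean01 (fun t => (leftQ G t) ^ 2) = μ ^ 2 + σ ^ 2}

/-- `F_{U,ξ}(μ,σ,ε)`: additionally within 2-Wasserstein distance `√ε` of `F`. -/
def FUEset (ξ : ℝ) (F : ℝ → ℝ) (μ σ ε : ℝ) : Set (ℝ → ℝ) :=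
  {G | G ∈ FUset ξ μ σ ∧
    Real.sqrt (∫ t in Ioo (0:ℝ) 1, (leftQ F t - leftQ G t) ^ 2) ≤ Real.sqrt ε}

/-- `F_{U,[ξ₁,ξ₂]}(μ,σ)`: unimodal with some inflection point in `[ξ₁,ξ₂]`. -/
def FUIset (ξ₁ ξ₂ μ σ : ℝ) : Set (ℝ → ℝ) :=
  {G | (∃ ξ ∈ Icc ξ₁ ξ₂, UnimodalCDF ξ G) ∧ mean01 (leftQ G) = μ ∧
    mean01 (fun t => (leftQ G t) ^ 2) = μ ^ 2 + σ ^ 2}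

/-- `f` is constant on `(0,1)`. -/
def ConstOn01 (f : ℝ → ℝ) : Prop := ∃ c : ℝ, ∀ t ∈ Ioo (0:ℝ) 1, f t = c
open scoped InnerProductSpace

section HilbertSpace

variable {E : Type*} [NormedAddCommGroup E] [InnerProductSpace ℝ E]

/-- Metric projections onto a convex set are nonexpansive. -/
lemma norm_sub_le_of_nearest {K : Set E} (hK : Convex ℝ K) {u v p q : E}
    (hp : p ∈ K) (hq : q ∈ K) (hup : ∀ w ∈ K, ‖u - p‖ ≤ ‖u - w‖)
    (hvq : ∀ w ∈ K, ‖v - q‖ ≤ ‖v - w‖) : ‖q - p‖ ≤ ‖v - u‖ := by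
  have inner_le {u p : E} (hp : p ∈ K) (hup : ∀ w ∈ K, ‖u - p‖ ≤ ‖u - w‖) :
      ∀ w ∈ K, ⟪u - p, w - p⟫_ℝ ≤ 0 := by
    refine (norm_eq_iInf_iff_real_inner_le_zero hK hp).1 (le_antisymm ?_ ?_)
    · have : Nonempty K := ⟨⟨p, hp⟩⟩
      exact le_ciInf fun w => hup w w.2
    · exact ciInf_le (f := fun w : K => ‖u - w‖)
        ⟨0, by rintro _ ⟨w, rfl⟩; exact norm_nonneg _⟩ ⟨p, hp⟩
  have h1 := inner_le hp hup q hq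
  have h2 := inner_le hq hvq p hp
  have h3 : ⟪v - u, q - p⟫_ℝ = ‖q - p‖ ^ 2 - ⟪v - q, p - q⟫_ℝ - ⟪u - p, q - p⟫_ℝ := by
    rw [← real_inner_self_eq_norm_sq, ← neg_sub q p, inner_neg_right, sub_neg_eq_add,
      ← inner_add_left, ← inner_sub_left]
    congr 1
    abel
  have h4 := real_inner_le_norm (v - u) (q - p)
  by_contra! h5
  nlinarith [norm_nonneg (v - u)]

/-- Removing the component along a unit vector does not increase the norm. -/
lemma norm_sub_inner_smul_le {e : E} (he : ‖e‖ = 1) (f : E) : ‖f - ⟪e, f⟫_ℝ • e‖ ≤ ‖f‖ := by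
  refine le_of_sq_le_sq ?_ (norm_nonneg _)
  rw [norm_sub_sq_real, inner_smul_right, real_inner_comm, norm_smul, he]
  simp only [mul_one, Real.norm_eq_abs, sq_abs]
  nlinarith [sq_nonneg ⟪e, f⟫_ℝ]

/-- Lipschitz estimate for the normalization map away from zero. -/
lemma norm_inv_smul_sub_inv_smul_le {c d : E} (hc : c ≠ 0) (hd : d ≠ 0) :
    ‖‖d‖⁻¹ • d - ‖c‖⁻¹ • c‖ ≤ 2 / ‖c‖ * ‖d - c‖ := by
  have hc' := norm_pos_iff.2 hc
  have hd' := norm_pos_iff.2 hd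
  have h1 : ‖d‖⁻¹ • d - ‖c‖⁻¹ • c = (‖d‖⁻¹ - ‖c‖⁻¹) • d + ‖c‖⁻¹ • (d - c) := by module
  have h2 : ‖(‖d‖⁻¹ - ‖c‖⁻¹) • d‖ = |‖c‖ - ‖d‖| / ‖c‖ := by
    have : ‖d‖⁻¹ - ‖c‖⁻¹ = (‖c‖ - ‖d‖) / (‖c‖ * ‖d‖) := by field_simp
    rw [norm_smul, this, Real.norm_eq_abs, abs_div, abs_of_pos (mul_pos hc' hd')]
    field_simp
  have h3 : ‖‖c‖⁻¹ • (d - c)‖ = ‖d - c‖ / ‖c‖ := by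
    rw [norm_smul, norm_inv, norm_norm, div_eq_inv_mul]
  have h4 : |‖c‖ - ‖d‖| / ‖c‖ ≤ ‖d - c‖ / ‖c‖ := by
    rw [norm_sub_rev d c]
    exact div_le_div_of_nonneg_right (abs_norm_sub_norm_le c d) hc'.le
  calc _ ≤ ‖(‖d‖⁻¹ - ‖c‖⁻¹) • d‖ + ‖‖c‖⁻¹ • (d - c)‖ := by rw [h1]; exact norm_add_le _ _
    _ ≤ ‖d - c‖ / ‖c‖ + ‖d - c‖ / ‖c‖ := by rw [h2, h3]; gcongr
    _ = _ := by ring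

end HilbertSpace

/-- The uniform distribution on `(0,1)`. -/
abbrev unif01 : Measure ℝ := volume.restrict (Ioo (0:ℝ) 1)

instance : IsProbabilityMeasure unif01 := ⟨by simp⟩

lemma inner_toLp_unif01 {f h : ℝ → ℝ} (hf : MemLp f 2 unif01) (hh : MemLp h 2 unif01) :
    ⟪hf.toLp f, hh.toLp h⟫_ℝ = ∫ u in Ioo (0:ℝ) 1, f u * h u := by
  rw [L2.inner_def]
  refine integral_congr_ae ?_
  filter_upwards [hf.coeFn_toLp, hh.coeFn_toLp] with u h1 h2
  simp [h1, h2, mul_comm]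

lemma norm_sq_toLp_unif01 {f : ℝ → ℝ} (hf : MemLp f 2 unif01) :
    ‖hf.toLp f‖ ^ 2 = ∫ u in Ioo (0:ℝ) 1, f u ^ 2 := by
  rw [← real_inner_self_eq_norm_sq, inner_toLp_unif01]
  simp only [sq]

lemma l2norm_eq_norm_toLp {f : ℝ → ℝ} (hf : MemLp f 2 unif01) : l2norm f = ‖hf.toLp f‖ := by
  rw [l2norm, ← norm_sq_toLp_unif01 hf, Real.sqrt_sq (norm_nonneg _)]

lemma memLp_const_unif01 (c : ℝ) : MemLp (fun _ : ℝ => c) 2 unif01 := memLp_const c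

lemma norm_toLp_one_unif01 : ‖(memLp_const_unif01 1).toLp‖ = 1 := by
  rw [← l2norm_eq_norm_toLp]
  simp [l2norm]

lemma mean01_eq_inner {f : ℝ → ℝ} (hf : MemLp f 2 unif01) :
    mean01 f = ⟪(memLp_const_unif01 1).toLp, hf.toLp f⟫_ℝ := by
  rw [inner_toLp_unif01]
  simp [mean01]

lemma memLp_sub_mean01 {f : ℝ → ℝ} (hf : MemLp f 2 unif01) :
    MemLp (fun u => f u - mean01 f) 2 unif01 := hf.sub (memLp_const_unif01 _)

lemma sd01_eq_norm_toLp {f : ℝ → ℝ} (hf : MemLp f 2 unif01) :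
    sd01 f = ‖(memLp_sub_mean01 hf).toLp‖ := l2norm_eq_norm_toLp _

lemma toLp_sub_mean01 {f : ℝ → ℝ} (hf : MemLp f 2 unif01) :
    (memLp_sub_mean01 hf).toLp = hf.toLp f -
      ⟪(memLp_const_unif01 1).toLp, hf.toLp f⟫_ℝ • (memLp_const_unif01 1).toLp := by
  rw [← mean01_eq_inner hf, ← MemLp.toLp_const_smul, ← MemLp.toLp_sub]
  refine MemLp.toLp_congr _ _ (Eventually.of_forall fun u => ?_)
  simp

/-- Centering does not increase the `L²(0,1)` distance. -/
lemma norm_toLp_sub_mean01_sub_le {f h : ℝ → ℝ} (hf : MemLp f 2 unif01)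
    (hh : MemLp h 2 unif01) :
    ‖(memLp_sub_mean01 hf).toLp - (memLp_sub_mean01 hh).toLp‖ ≤ ‖hf.toLp f - hh.toLp h‖ := by
  refine le_of_eq_of_le (congrArg norm ?_)
    (norm_sub_inner_smul_le norm_toLp_one_unif01 (hf.toLp f - hh.toLp h))
  rw [toLp_sub_mean01 hf, toLp_sub_mean01 hh, inner_sub_right, sub_smul]
  abel

lemma UQuant.memLp {ξ : ℝ} {h : ℝ → ℝ} (hh : UQuant ξ h) : MemLp h 2 unif01 :=
  (memLp_two_iff_integrable_sq (hh.2.1.aestronglyMeasurable measurableSet_Ioo)).2 hh.2.2.2.2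

/-- Unimodal quantile functions form a convex set. -/
lemma UQuant.convexCombination {ξ a b : ℝ} {f h : ℝ → ℝ} (hf : UQuant ξ f) (hh : UQuant ξ h)
    (ha : 0 ≤ a) (hb : 0 ≤ b) : UQuant ξ (fun u => a * f u + b * h u) := by
  refine ⟨?_, ?_, ?_, ?_, ?_⟩
  · intro x hx y hy hxy
    exact add_le_add (mul_le_mul_of_nonneg_left (hf.1 hx hy hxy) ha)
      (mul_le_mul_of_nonneg_left (hh.1 hx hy hxy) hb)
  · exact (continuousOn_const.mul hf.2.1).add (continuousOn_const.mul hh.2.1)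
  · exact (hf.2.2.1.smul ha).add (hh.2.2.1.smul hb)
  · exact (hf.2.2.2.1.smul ha).add (hh.2.2.2.1.smul hb)
  · exact ((hf.memLp.const_mul a).add (hh.memLp.const_mul b)).integrable_sq

/-- `F⁻¹_{U,ξ}` as a subset of `L²(0,1)`. -/
def uquantLp (ξ : ℝ) : Set (Lp ℝ 2 unif01) :=
  {w | ∃ (h : ℝ → ℝ) (hh : UQuant ξ h), w = hh.memLp.toLp h}

lemma convex_uquantLp (ξ : ℝ) : Convex ℝ (uquantLp ξ) := by
  rintro _ ⟨f, hf, rfl⟩ _ ⟨h, hh, rfl⟩ a b ha hb -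
  refine ⟨_, hf.convexCombination hh ha hb, ?_⟩
  rw [← MemLp.toLp_const_smul, ← MemLp.toLp_const_smul, ← MemLp.toLp_add]
  rfl

lemma IsProj.norm_toLp_sub_le {ξ : ℝ} {γ γp : ℝ → ℝ} (hp : IsProj ξ γ γp)
    (hγ : MemLp γ 2 unif01) :
    ∀ w ∈ uquantLp ξ, ‖hγ.toLp γ - hp.1.memLp.toLp γp‖ ≤ ‖hγ.toLp γ - w‖ := by
  rintro _ ⟨h, hh, rfl⟩
  refine le_of_sq_le_sq ?_ (norm_nonneg _)
  rw [← MemLp.toLp_sub, ← MemLp.toLp_sub, norm_sq_toLp_unif01, norm_sq_toLp_unif01]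
  exact hp.2 h hh

/-- A continuous function on `(0,1)` that is not constant has nonzero centered part. -/
lemma toLp_sub_mean01_ne_zero {f : ℝ → ℝ} (hf : MemLp f 2 unif01)
    (hc : ContinuousOn f (Ioo 0 1)) (hnc : ¬ ConstOn01 f) :
    (memLp_sub_mean01 hf).toLp ≠ 0 := by
  intro h0
  refine hnc ⟨mean01 f, ?_⟩
  have h1 : f =ᵐ[unif01] fun _ => mean01 f := by
    have h2 := (memLp_sub_mean01 hf).coeFn_toLp
    rw [h0] at h2
    filter_upwards [h2, Lp.coeFn_zero ℝ 2 unif01] with u h3 h4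
    rw [h4] at h3
    exact sub_eq_zero.1 h3.symm
  exact Measure.eqOn_open_of_ae_eq h1 isOpen_Ioo hc continuousOn_const

/-- The left derivative of an arbitrary function, read backwards from `1`, is measurable. -/
lemma measurable_derivWithin_Iio_one_sub (g : ℝ → ℝ) :
    Measurable fun u : ℝ => derivWithin g (Iio (1 - u)) (1 - u) := by
  have h := (measurable_derivWithin_Ioi fun u => g (1 - u)).neg
  convert h using 2 with u
  simp only [Pi.neg_apply]
  rw [derivWithin_comp_const_sub, neg_neg]
  congr 1
  ext z
  simp [mem_vadd_set_iff_neg_vadd_mem]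
  constructor <;> intro h <;> linarith

lemma memLp_of_leftDeriv {g γ : ℝ → ℝ} (hγ2 : IntegrableOn (fun u => (γ u) ^ 2) (Ioo (0:ℝ) 1))
    (hgγ : ∀ x ∈ Ioo (0:ℝ) 1, γ (1 - x) = derivWithin g (Iio x) x) : MemLp γ 2 unif01 := by
  refine (memLp_two_iff_integrable_sq ?_).2 hγ2
  refine (measurable_derivWithin_Iio_one_sub g).aestronglyMeasurable.congr ?_
  filter_upwards [ae_restrict_mem measurableSet_Ioo] with u hu
  rw [← hgγ (1 - u) ⟨by linarith [hu.2], by linarith [hu.1]⟩, sub_sub_cancel]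

/-- A function constant on each open cell of a finite partition is integrable. -/
lemma integrableOn_of_step {f : ℝ → ℝ} {x y : ℕ → ℝ} {m : ℕ} (hx : ∀ i < m, x i < x (i + 1))
    (hf : ∀ i < m, ∀ u ∈ Ioo (x i) (x (i + 1)), f u = y i) :
    x 0 ≤ x m ∧ IntegrableOn f (Ioc (x 0) (x m)) := by
  induction m with
  | zero => simp
  | succ m ih =>
    obtain ⟨h1, h2⟩ := ih (fun i hi => hx i (by omega)) (fun i hi => hf i (by omega))
    have h3 := hx m (by omega)
    refine ⟨h1.trans h3.le, ?_⟩
    rw [← Ioc_union_Ioc_eq_Ioc h1 h3.le]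
    refine h2.union ?_
    rw [integrableOn_Ioc_iff_integrableOn_Ioo]
    exact (integrableOn_congr_fun (hf m (by omega)) measurableSet_Ioo).2
      (integrableOn_const (by simp))

lemma memLp_of_step {f : ℝ → ℝ} (hstep : ∃ (m : ℕ) (x y : ℕ → ℝ), x 0 = 0 ∧ x m = 1 ∧
      (∀ i < m, x i < x (i + 1)) ∧ ∀ i < m, ∀ u ∈ Ioo (x i) (x (i + 1)), f u = y i) :
    MemLp f 2 unif01 := by
  obtain ⟨m, x, y, h0, h1, hx, hf⟩ := hstep
  have h2 := (integrableOn_of_step hx hf).2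
  have h3 := (integrableOn_of_step (f := fun u => f u ^ 2) (y := fun i => y i ^ 2) hx
    fun i hi u hu => by rw [hf i hi u hu]).2
  rw [h0, h1, integrableOn_Ioc_iff_integrableOn_Ioo] at h2 h3
  exact (memLp_two_iff_integrable_sq h2.aestronglyMeasurable).2 h3

lemma memLp_standardize (μ σ : ℝ) {f : ℝ → ℝ} (hf : MemLp f 2 unif01) :
    MemLp (fun u => μ + σ * (f u - mean01 f) / sd01 f) 2 unif01 := by
  simp only [div_eq_inv_mul]
  exact (memLp_const_unif01 μ).add (((memLp_sub_mean01 hf).const_mul σ).const_mul (sd01 f)⁻¹)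

lemma toLp_standardize (μ σ : ℝ) {f : ℝ → ℝ} (hf : MemLp f 2 unif01) :
    (memLp_standardize μ σ hf).toLp = (memLp_const_unif01 μ).toLp +
      σ • (‖(memLp_sub_mean01 hf).toLp‖⁻¹ • (memLp_sub_mean01 hf).toLp) := by
  rw [← sd01_eq_norm_toLp hf, ← MemLp.toLp_const_smul, ← MemLp.toLp_const_smul, ← MemLp.toLp_add]
  refine MemLp.toLp_congr _ _ (Eventually.of_forall fun u => ?_)
  simp only [Pi.add_apply, Pi.smul_apply, smul_eq_mul]
  ring

/-- Stability of standardization in `L²(0,1)`. -/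
lemma norm_toLp_standardize_sub_le (μ : ℝ) {σ : ℝ} (hσ : 0 ≤ σ) {f h : ℝ → ℝ}
    (hf : MemLp f 2 unif01) (hh : MemLp h 2 unif01) (hf0 : (memLp_sub_mean01 hf).toLp ≠ 0)
    (hh0 : (memLp_sub_mean01 hh).toLp ≠ 0) :
    ‖(memLp_standardize μ σ hh).toLp - (memLp_standardize μ σ hf).toLp‖ ≤
      2 * (σ / sd01 f) * ‖hh.toLp h - hf.toLp f‖ := by
  rw [toLp_standardize μ σ hh, toLp_standardize μ σ hf, add_sub_add_left_eq_sub, ← smul_sub, norm_smul,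
    Real.norm_of_nonneg hσ, sd01_eq_norm_toLp hf]
  calc _ ≤ σ * (2 / ‖(memLp_sub_mean01 hf).toLp‖ * ‖hh.toLp h - hf.toLp f‖) := by
        gcongr
        refine (norm_inv_smul_sub_inv_smul_le hf0 hh0).trans ?_
        gcongr
        exact norm_toLp_sub_mean01_sub_le hh hf
    _ = _ := by ring

lemma l2norm_sub_eq_norm_toLp {f h : ℝ → ℝ} (hf : MemLp f 2 unif01) (hh : MemLp h 2 unif01) :
    l2norm (fun u => f u - h u) = ‖hf.toLp f - hh.toLp h‖ := by
  rw [← MemLp.toLp_sub]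
  exact l2norm_eq_norm_toLp (hf.sub hh)

lemma l2norm_nonneg (f : ℝ → ℝ) : 0 ≤ l2norm f := Real.sqrt_nonneg _

/-- Projection onto the unimodal quantile functions is nonexpansive. -/
lemma IsProj.l2norm_sub_le {ξ : ℝ} {γ γn γp γpn : ℝ → ℝ} (hγ : MemLp γ 2 unif01)
    (hγn : MemLp γn 2 unif01) (hp : IsProj ξ γ γp) (hpn : IsProj ξ γn γpn) :
    l2norm (fun u => γpn u - γp u) ≤ l2norm (fun u => γn u - γ u) := by
  rw [l2norm_sub_eq_norm_toLp hpn.1.memLp hp.1.memLp, l2norm_sub_eq_norm_toLp hγn hγ]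
  exact norm_sub_le_of_nearest (convex_uquantLp ξ) ⟨_, hp.1, rfl⟩ ⟨_, hpn.1, rfl⟩
    (hp.norm_toLp_sub_le hγ) (hpn.norm_toLp_sub_le hγn)

lemma l2norm_standardize_sub_le (μ : ℝ) {σ : ℝ} (hσ : 0 ≤ σ) {f h : ℝ → ℝ}
    (hf : MemLp f 2 unif01) (hh : MemLp h 2 unif01) (hf0 : (memLp_sub_mean01 hf).toLp ≠ 0)
    (hh0 : (memLp_sub_mean01 hh).toLp ≠ 0) :
    l2norm (fun u => (μ + σ * (h u - mean01 h) / sd01 h) - (μ + σ * (f u - mean01 f) / sd01 f)) ≤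
      2 * (σ / sd01 f) * l2norm (fun u => h u - f u) := by
  rw [l2norm_sub_eq_norm_toLp (memLp_standardize μ σ hh) (memLp_standardize μ σ hf),
    l2norm_sub_eq_norm_toLp hh hf]
  exact norm_toLp_standardize_sub_le μ hσ hf hh hf0 hh0

lemma abs_rhoQ_sub_le {γ f h : ℝ → ℝ} (hγ : MemLp γ 2 unif01) (hf : MemLp f 2 unif01)
    (hh : MemLp h 2 unif01) :
    |rhoQ γ f - rhoQ γ h| ≤ l2norm γ * l2norm (fun u => h u - f u) := by
  rw [rhoQ, rhoQ, ← inner_toLp_unif01 hγ hf, ← inner_toLp_unif01 hγ hh, ← inner_sub_right,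
    l2norm_sub_eq_norm_toLp hh hf, l2norm_eq_norm_toLp hγ, norm_sub_rev]
  exact abs_real_inner_le_norm _ _

theorem stmt_12 (ξ μ σ : ℝ) (hξ : ξ ∈ Icc (0:ℝ) 1) (hσ : 0 < σ)
    (g γ γn : ℝ → ℝ) (hγ2 : IntegrableOn (fun u => (γ u) ^ 2) (Ioo (0:ℝ) 1))
    (hg0 : g 0 = 0)
    (hgγ : ∀ x ∈ Ioo (0:ℝ) 1, γ (1 - x) = derivWithin g (Iio x) x)
    (hstep : ∃ (m : ℕ) (x y : ℕ → ℝ), x 0 = 0 ∧ x m = 1 ∧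
      (∀ i < m, x i < x (i + 1)) ∧ ∀ i < m, ∀ u ∈ Ioo (x i) (x (i + 1)), γn u = y i)
    (γp γpn : ℝ → ℝ) (hp : IsProj ξ γ γp) (hpn : IsProj ξ γn γpn)
    (hnc : ¬ ConstOn01 γp) (hncn : ¬ ConstOn01 γpn) :
    l2norm (fun u => γpn u - γp u) ≤ l2norm (fun u => γn u - γ u) ∧
    l2norm (fun u => (μ + σ * (γpn u - mean01 γpn) / sd01 γpn)
        - (μ + σ * (γp u - mean01 γp) / sd01 γp))
      ≤ (2 + (2 * l2norm γ + l2norm γn) / sd01 γp) * (σ / sd01 γp)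
          * l2norm (fun u => γn u - γ u) ∧
    |rhoQ γ (fun u => μ + σ * (γp u - mean01 γp) / sd01 γp)
        - rhoQ γ (fun u => μ + σ * (γpn u - mean01 γpn) / sd01 γpn)|
      ≤ σ * (2 * l2norm γ + l2norm γn) * l2norm (fun u => γn u - γ u) / sd01 γp := by
  have hγ := memLp_of_leftDeriv hγ2 hgγ
  have hγn := memLp_of_step hstep
  have hq := hp.1.memLp
  have hqn := hpn.1.memLp
  have hq0 := toLp_sub_mean01_ne_zero hq hp.1.2.1 hnc
  have hqn0 := toLp_sub_mean01_ne_zero hqn hpn.1.2.1 hncn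
  have hb : 0 < sd01 γp := by rw [sd01_eq_norm_toLp hq]; exact norm_pos_iff.2 hq0
  have hproj := IsProj.l2norm_sub_le hγ hγn hp hpn
  have hstd := (l2norm_standardize_sub_le μ hσ.le hq hqn hq0 hqn0).trans
    (mul_le_mul_of_nonneg_left hproj (by positivity))
  have hrho := abs_rhoQ_sub_le hγ (memLp_standardize μ σ hq) (memLp_standardize μ σ hqn)
  have hA := l2norm_nonneg γ
  have hB := l2norm_nonneg γn
  have hD := l2norm_nonneg fun u => γn u - γ u
  refine ⟨hproj, hstd.trans ?_, hrho.trans ?_⟩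
  · gcongr
    exact le_add_of_nonneg_right (by positivity)
  · calc _ ≤ l2norm γ * (2 * (σ / sd01 γp) * l2norm (fun u => γn u - γ u)) := by gcongr
      _ = σ * (2 * l2norm γ) * l2norm (fun u => γn u - γ u) / sd01 γp := by ring
      _ ≤ _ := by
        gcongr
        exact le_add_of_nonneg_right hB

end
end

section
/- Let γ(u) = −1 for u ∈ (0,1/2) and γ(u) = 1 for u ∈ (1/2,1) (the weight function of the mean-median deviation, whose distortion function is g(t) = min(t, 1−t)). Then the L²(0,1)-projection of γ onto F⁻¹_{U,1/2} is the function u ↦ 3(u − 1/2), u ∈ (0,1); that is, u ↦ 3(u − 1/2) is the unique minimizer of ∫₀¹ (γ(u) − h(u))² du over h ∈ F⁻¹_{U,1/2}. -/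
open MeasureTheory Set Filter

noncomputable section

/-- The chord inequality for a convex function on an open interval extends to the left endpoint
when the function is right-continuous there. -/
theorem ConvexOn.chord_le_of_continuousWithinAt {a b : ℝ} {h : ℝ → ℝ}
    (hconv : ConvexOn ℝ (Ioo a b) h) (hcont : ContinuousWithinAt h (Ioi a) a)
    {x y : ℝ} (hax : a < x) (hxy : x < y) (hyb : y < b) :
    (y - a) * h x ≤ (y - x) * h a + (x - a) * h y := by
  have hid : Tendsto (fun t : ℝ => t) (nhdsWithin a (Ioi a)) (nhds a) :=
    tendsto_id.mono_left nhdsWithin_le_nhds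
  have hlhs : Tendsto (fun t => (y - t) * h x) (nhdsWithin a (Ioi a)) (nhds ((y - a) * h x)) :=
    (tendsto_const_nhds.sub hid).mul tendsto_const_nhds
  have hrhs : Tendsto (fun t => (y - x) * h t + (x - t) * h y) (nhdsWithin a (Ioi a))
      (nhds ((y - x) * h a + (x - a) * h y)) :=
    (tendsto_const_nhds.mul hcont).add ((tendsto_const_nhds.sub hid).mul tendsto_const_nhds)
  refine le_of_tendsto_of_tendsto hlhs hrhs ?_
  filter_upwards [Ioo_mem_nhdsGT hax] with t ht
  have hslope := hconv.slope_mono_adjacent ⟨ht.1, by linarith [ht.2]⟩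
    ⟨by linarith, hyb⟩ ht.2 hxy
  rw [div_le_div_iff₀ (by linarith [ht.2]) (by linarith)] at hslope
  linarith

/-- A convex function on `[1/2, 1)` is compared with its chord through `1/2` and `5/6`, the
zero of the weight `1 - 3 * (u - 1/2)`. -/
theorem ConvexOn.weight_mul_sub_chord_nonpos {h : ℝ → ℝ}
    (hconv : ConvexOn ℝ (Ioo (1/2 : ℝ) 1) h) (hcont : ContinuousWithinAt h (Ioi (1/2)) (1/2)) :
    ∃ b : ℝ, ∀ u ∈ Ioo (1/2 : ℝ) 1,
      (1 - 3 * (u - 1/2)) * (h u - (h (1/2) + b * (u - 1/2))) ≤ 0 := by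
  refine ⟨3 * (h (5/6) - h (1/2)), fun u hu => ?_⟩
  rcases lt_trichotomy u (5/6) with hlt | rfl | hgt
  · have := hconv.chord_le_of_continuousWithinAt hcont hu.1 hlt (by norm_num)
    exact mul_nonpos_of_nonneg_of_nonpos (by linarith) (by linarith)
  · norm_num
  · have := hconv.chord_le_of_continuousWithinAt hcont (by norm_num) hgt hu.2
    exact mul_nonpos_of_nonpos_of_nonneg (by linarith) (by linarith)

theorem ConcaveOn.weight_mul_sub_chord_nonpos {h : ℝ → ℝ}
    (hconc : ConcaveOn ℝ (Ioo (0 : ℝ) (1/2)) h)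
    (hcont : ContinuousWithinAt h (Iio (1/2)) (1/2)) :
    ∃ b : ℝ, ∀ u ∈ Ioo (0 : ℝ) (1/2),
      (-1 - 3 * (u - 1/2)) * (h u - (h (1/2) + b * (u - 1/2))) ≤ 0 := by
  have hconv : ConvexOn ℝ (Ioo (1/2 : ℝ) 1) (fun u => -h (1 - u)) := by
    refine ⟨convex_Ioo _ _, fun x hx y hy a b ha hb hab => ?_⟩
    have := hconc.2 (x := 1 - x) (y := 1 - y) ⟨by linarith [hx.2], by linarith [hx.1]⟩
      ⟨by linarith [hy.2], by linarith [hy.1]⟩ ha hb hab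
    have heq : a • (1 - x) + b • (1 - y) = 1 - (a • x + b • y) := by
      simp only [smul_eq_mul]
      linear_combination hab
    rw [heq] at this
    simp only [smul_eq_mul] at this ⊢
    linarith
  have hcont' : ContinuousWithinAt (fun u => -h (1 - u)) (Ioi (1/2 : ℝ)) (1/2) := by
    refine ContinuousWithinAt.neg (ContinuousWithinAt.comp (t := Iio (1/2 : ℝ)) ?_ ?_ ?_)
    · norm_num at hcont ⊢
      exact hcont
    · fun_prop
    · intro u hu
      simp only [mem_Ioi, mem_Iio] at hu ⊢
      linarith
  obtain ⟨b, hb⟩ := hconv.weight_mul_sub_chord_nonpos hcont'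
  refine ⟨b, fun u hu => ?_⟩
  have := hb (1 - u) ⟨by linarith [hu.2], by linarith [hu.1]⟩
  norm_num at this ⊢
  linarith

theorem setIntegral_Ioo_split {f : ℝ → ℝ} {a b c : ℝ} (hab : a < b) (hbc : b < c)
    (hf₁ : IntegrableOn f (Ioo a b)) (hf₂ : IntegrableOn f (Ioo b c)) :
    ∫ u in Ioo a c, f u = (∫ u in Ioo a b, f u) + ∫ u in Ioo b c, f u := by
  rw [← integrableOn_Ioc_iff_integrableOn_Ioo] at hf₁
  rw [← Ioc_union_Ioo_eq_Ioo hab.le hbc, setIntegral_union _ measurableSet_Ioo hf₁ hf₂,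
    integral_Ioc_eq_integral_Ioo]
  exact disjoint_left.2 fun x hx hx' => hx.2.not_gt hx'.1

theorem integrableOn_affine_sub_sq {h : ℝ → ℝ} {s : Set ℝ} (hs : Bornology.IsBounded s)
    (hms : MeasurableSet s) (hcont : ContinuousOn h s)
    (hint : IntegrableOn (fun u => h u ^ 2) s) (k c : ℝ) :
    IntegrableOn (fun u => (k * u + c - h u) ^ 2) s := by
  have hh : MemLp h 2 (volume.restrict s) :=
    (memLp_two_iff_integrable_sq (hcont.aestronglyMeasurable hms)).2 hint
  obtain ⟨a, b, hab⟩ : ∃ a b, s ⊆ Icc a b := by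
    obtain ⟨r, hr⟩ := hs.subset_closedBall 0
    exact ⟨0 - r, 0 + r, by rwa [← Real.closedBall_eq_Icc]⟩
  have hp : MemLp (fun u : ℝ => k * u + c) 2 (volume.restrict s) := by
    refine (memLp_two_iff_integrable_sq (by fun_prop)).2 ?_
    exact (Continuous.integrableOn_Icc (by fun_prop)).mono_set hab
  exact (hp.sub hh).integrable_sq

/-- Half of the variational inequality: on an interval where `γ` equals the constant `ε`, a
pointwise comparison with an affine function bounds the squared distance to `γ` from below. -/
theorem sq_dist_lower_bound {h : ℝ → ℝ} {a b ε c m : ℝ} (hab : a ≤ b)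
    (hcont : ContinuousOn h (Ioo a b)) (hint : IntegrableOn (fun u => h u ^ 2) (Ioo a b))
    (hle : ∀ u ∈ Ioo a b, (ε - 3 * (u - 1/2)) * (h u - (c + m * (u - 1/2))) ≤ 0) :
    (∫ u in Ioo a b, (ε - 3 * (u - 1/2)) ^ 2) + (∫ u in Ioo a b, (3 * (u - 1/2) - h u) ^ 2)
      + (∫ u in a..b, 2 * ((ε - 3 * (u - 1/2)) * (3 * (u - 1/2) - (c + m * (u - 1/2)))))
      ≤ ∫ u in Ioo a b, (ε - h u) ^ 2 := by
  have hpoly {f : ℝ → ℝ} (hf : Continuous f) : IntegrableOn f (Ioo a b) :=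
    (hf.integrableOn_Icc).mono_set Ioo_subset_Icc_self
  have hph : IntegrableOn (fun u => (3 * (u - 1/2) - h u) ^ 2) (Ioo a b) := by
    convert integrableOn_affine_sub_sq (Metric.isBounded_Ioo a b) measurableSet_Ioo hcont hint
      3 (-(3 / 2)) using 3
    ring
  have hεh : IntegrableOn (fun u => (ε - h u) ^ 2) (Ioo a b) := by
    simpa using integrableOn_affine_sub_sq (Metric.isBounded_Ioo a b) measurableSet_Ioo hcont
      hint 0 ε
  have hγp := hpoly (f := fun u => (ε - 3 * (u - 1/2)) ^ 2) (by fun_prop)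
  have hcross := hpoly (f := fun u =>
    2 * ((ε - 3 * (u - 1/2)) * (3 * (u - 1/2) - (c + m * (u - 1/2))))) (by fun_prop)
  have hsum : IntegrableOn
      (fun u => (ε - 3 * (u - 1/2)) ^ 2 + (3 * (u - 1/2) - h u) ^ 2) (Ioo a b) := hγp.add hph
  rw [intervalIntegral.integral_of_le hab, integral_Ioc_eq_integral_Ioo,
    ← integral_add hγp hph, ← integral_add hsum hcross]
  refine setIntegral_mono_on (hsum.add hcross) hεh measurableSet_Ioo fun u hu => ?_
  linarith [hle u hu]

theorem setIntegral_sq_sub_of_eq_neg_one_one {γ f : ℝ → ℝ}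
    (hγ₁ : ∀ u ∈ Ioo (0:ℝ) (1/2), γ u = -1) (hγ₂ : ∀ u ∈ Ioo (1/2:ℝ) 1, γ u = 1)
    (hcont : ContinuousOn f (Ioo 0 1)) (hint : IntegrableOn (fun u => f u ^ 2) (Ioo (0:ℝ) 1)) :
    ∫ u in Ioo (0:ℝ) 1, (γ u - f u) ^ 2
      = (∫ u in Ioo (0:ℝ) (1/2), (-1 - f u) ^ 2) + ∫ u in Ioo (1/2:ℝ) 1, (1 - f u) ^ 2 := by
  have hl : Ioo (0:ℝ) (1/2) ⊆ Ioo 0 1 := Ioo_subset_Ioo_right (by norm_num)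
  have hr : Ioo (1/2:ℝ) 1 ⊆ Ioo 0 1 := Ioo_subset_Ioo_left (by norm_num)
  have hcl : EqOn (fun u => (γ u - f u) ^ 2) (fun u => (-1 - f u) ^ 2) (Ioo 0 (1/2)) :=
    fun u hu => by simp only [hγ₁ u hu]
  have hcr : EqOn (fun u => (γ u - f u) ^ 2) (fun u => (1 - f u) ^ 2) (Ioo (1/2) 1) :=
    fun u hu => by simp only [hγ₂ u hu]
  rw [← setIntegral_congr_fun measurableSet_Ioo hcl, ← setIntegral_congr_fun measurableSet_Ioo hcr]
  refine setIntegral_Ioo_split (by norm_num) (by norm_num)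
    (IntegrableOn.congr_fun ?_ hcl.symm measurableSet_Ioo)
    (IntegrableOn.congr_fun ?_ hcr.symm measurableSet_Ioo)
  · simpa using integrableOn_affine_sub_sq (Metric.isBounded_Ioo _ _) measurableSet_Ioo
      (hcont.mono hl) (hint.mono_set hl) 0 (-1)
  · simpa using integrableOn_affine_sub_sq (Metric.isBounded_Ioo _ _) measurableSet_Ioo
      (hcont.mono hr) (hint.mono_set hr) 0 1

theorem UQuant.integrableOn_sq_sub {ξ : ℝ} {h : ℝ → ℝ} (hh : UQuant ξ h) :
    IntegrableOn (fun u => (3 * (u - 1/2) - h u) ^ 2) (Ioo (0:ℝ) 1) := by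
  obtain ⟨-, hcont, -, -, hint⟩ := hh
  convert integrableOn_affine_sub_sq (Metric.isBounded_Ioo _ _) measurableSet_Ioo hcont hint
    3 (-(3 / 2)) using 3
  ring

theorem uQuant_affine (ξ : ℝ) : UQuant ξ (fun u => 3 * (u - 1/2)) := by
  refine ⟨fun x _ y _ hxy => ?_, by fun_prop, ⟨convex_Ioo _ _, ?_⟩, ⟨convex_Ioo _ _, ?_⟩,
    (Continuous.integrableOn_Icc (by fun_prop)).mono_set Ioo_subset_Icc_self⟩
  · simp only
    linarith
  all_goals
    intro x _ y _ a b _ _ hab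
    simp only [smul_eq_mul]
    refine le_of_eq ?_
    first | linear_combination (3 / 2) * hab | linear_combination -(3 / 2) * hab

theorem UQuant.integral_sq_sub_add_le {γ h : ℝ → ℝ}
    (hγ₁ : ∀ u ∈ Ioo (0:ℝ) (1/2), γ u = -1) (hγ₂ : ∀ u ∈ Ioo (1/2:ℝ) 1, γ u = 1)
    (hh : UQuant (1/2) h) :
    (∫ u in Ioo (0:ℝ) 1, (γ u - 3 * (u - 1/2)) ^ 2)
      + (∫ u in Ioo (0:ℝ) 1, (3 * (u - 1/2) - h u) ^ 2)
      ≤ ∫ u in Ioo (0:ℝ) 1, (γ u - h u) ^ 2 := by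
  have hph := hh.integrableOn_sq_sub
  obtain ⟨-, hcont, hconc, hconv, hint⟩ := hh
  obtain ⟨-, hpcont, -, -, hpint⟩ := uQuant_affine (1/2)
  have hat : ContinuousAt h (1/2) := hcont.continuousAt (Ioo_mem_nhds (by norm_num) (by norm_num))
  have hl : Ioo (0:ℝ) (1/2) ⊆ Ioo 0 1 := Ioo_subset_Ioo_right (by norm_num)
  have hr : Ioo (1/2:ℝ) 1 ⊆ Ioo 0 1 := Ioo_subset_Ioo_left (by norm_num)
  obtain ⟨m₁, hm₁⟩ := hconc.weight_mul_sub_chord_nonpos hat.continuousWithinAt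
  obtain ⟨m₂, hm₂⟩ := hconv.weight_mul_sub_chord_nonpos hat.continuousWithinAt
  have h₁ := sq_dist_lower_bound (by norm_num) (hcont.mono hl) (hint.mono_set hl) hm₁
  have h₂ := sq_dist_lower_bound (by norm_num) (hcont.mono hr) (hint.mono_set hr) hm₂
  have hcross (ε c m a b : ℝ) :
      ∫ u in a..b, 2 * ((ε - 3 * (u - 1/2)) * (3 * (u - 1/2) - (c + m * (u - 1/2))))
        = (2 * (-ε * c * (b - 1/2) + (ε * (3 - m) + 3 * c) * (b - 1/2) ^ 2 / 2
            - (3 - m) * (b - 1/2) ^ 3))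
          - 2 * (-ε * c * (a - 1/2) + (ε * (3 - m) + 3 * c) * (a - 1/2) ^ 2 / 2
            - (3 - m) * (a - 1/2) ^ 3) := by
    refine intervalIntegral.integral_eq_sub_of_hasDerivAt (f := fun u =>
      2 * (-ε * c * (u - 1/2) + (ε * (3 - m) + 3 * c) * (u - 1/2) ^ 2 / 2
            - (3 - m) * (u - 1/2) ^ 3)) (fun u _ => ?_)
      (Continuous.intervalIntegrable (by fun_prop) _ _)
    have hd : HasDerivAt (fun u : ℝ => u - 1/2) 1 u := (hasDerivAt_id u).sub_const _
    refine ((((hd.const_mul (-ε * c)).add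
      (((hd.pow 2).const_mul (ε * (3 - m) + 3 * c)).div_const 2)).sub
        ((hd.pow 3).const_mul (3 - m))).const_mul 2).congr_deriv ?_
    push_cast
    ring
  rw [hcross] at h₁ h₂
  rw [setIntegral_sq_sub_of_eq_neg_one_one hγ₁ hγ₂ hcont hint,
    setIntegral_sq_sub_of_eq_neg_one_one hγ₁ hγ₂ hpcont hpint,
    setIntegral_Ioo_split (by norm_num) (by norm_num) (hph.mono_set hl) (hph.mono_set hr)]
  linarith

theorem stmt_13 (γ : ℝ → ℝ)
    (hγ₁ : ∀ u ∈ Ioo (0:ℝ) (1/2), γ u = -1)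
    (hγ₂ : ∀ u ∈ Ioo (1/2:ℝ) 1, γ u = 1) :
    IsProj (1/2) γ (fun u => 3 * (u - 1/2)) ∧
    ∀ h : ℝ → ℝ, UQuant (1/2) h →
      (∫ u in Ioo (0:ℝ) 1, (γ u - h u) ^ 2)
        = (∫ u in Ioo (0:ℝ) 1, (γ u - 3 * (u - 1/2)) ^ 2) →
      ∀ u ∈ Ioo (0:ℝ) 1, h u = 3 * (u - 1/2) := by
  refine ⟨⟨uQuant_affine _, fun h hh => ?_⟩, fun h hh heq => ?_⟩
  · have hle := hh.integral_sq_sub_add_le hγ₁ hγ₂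
    have hnonneg : 0 ≤ ∫ u in Ioo (0:ℝ) 1, (3 * (u - 1/2) - h u) ^ 2 :=
      integral_nonneg fun u => sq_nonneg _
    exact (le_add_of_nonneg_right hnonneg).trans hle
  · have hle := hh.integral_sq_sub_add_le hγ₁ hγ₂
    have hzero : ∫ u in Ioo (0:ℝ) 1, (3 * (u - 1/2) - h u) ^ 2 = 0 :=
      le_antisymm (by linarith) (integral_nonneg fun u => sq_nonneg _)
    have hae := (integral_eq_zero_iff_of_nonneg (fun u => sq_nonneg _)
      hh.integrableOn_sq_sub).1 hzero
    refine Measure.eqOn_open_of_ae_eq (μ := volume) ?_ isOpen_Ioo hh.2.1 (by fun_prop)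
    filter_upwards [hae] with u hu
    exact (sub_eq_zero.1 (pow_eq_zero_iff two_ne_zero |>.1 hu)).symm

end
end
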